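/- For every i ∈ ℤ/rℤ with i ∈ J, one has n'_i + p·ι_{i−1} − p·α_i ≥ n_i, where ι_{i−1} = α_i − β_i + e·δ_J(i). -/

import Mathlib

open Finset

/-- Indicator function (as an integer) of a subset `J ⊆ ℤ/rℤ`:
`dlt J i = 1` if `i ∈ J` and `0` otherwise.  Note that the indicator of the
complement `Jᶜ` is `1 - dlt J i`. -/
def dlt {r : ℕ} (J : Finset (ZMod r)) (i : ZMod r) : ℤ :=
  if i ∈ J then 1 else 0

/-- `α_i = Σ_{j=0}^{r−1} p^{r−1−j} (b_{i+j} δ_{J^c}(i+j) − δ_{J^c}(i+j+1))`. -/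
def alph (p r : ℕ) (J : Finset (ZMod r)) (b : ZMod r → ℤ) (i : ZMod r) : ℤ :=
  ∑ j ∈ Finset.range r, (p : ℤ) ^ (r - 1 - j) *
    (b (i + (j : ZMod r)) * (1 - dlt J (i + (j : ZMod r))) -
      (1 - dlt J (i + (j : ZMod r) + 1)))

/-- `β_i = Σ_{j=0}^{r−1} p^{r−1−j} (b_{i+j} δ_J(i+j) − δ_J(i+j+1))`. -/
def bet (p r : ℕ) (J : Finset (ZMod r)) (b : ZMod r → ℤ) (i : ZMod r) : ℤ :=
  ∑ j ∈ Finset.range r, (p : ℤ) ^ (r - 1 - j) *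
    (b (i + (j : ZMod r)) * dlt J (i + (j : ZMod r)) -
      dlt J (i + (j : ZMod r) + 1))

/-- `n_i = (p−2−δ_{J^c}(i)·b_i)·e + p·δ_{J^c}(i)·α_i − δ_{J^c}(i+1)·α_{i+1}`,
where `e = p^r − 1`. -/
def nn (p r : ℕ) (J : Finset (ZMod r)) (b : ZMod r → ℤ) (i : ZMod r) : ℤ :=
  ((p : ℤ) - 2 - (1 - dlt J i) * b i) * ((p : ℤ) ^ r - 1) +
    (p : ℤ) * (1 - dlt J i) * alph p r J b i -
      (1 - dlt J (i + 1)) * alph p r J b (i + 1)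

/-- `n'_i = (p−2−δ_J(i)·b_i)·e + p·δ_J(i)·β_i − δ_J(i+1)·β_{i+1}`,
where `e = p^r − 1`. -/
def nn' (p r : ℕ) (J : Finset (ZMod r)) (b : ZMod r → ℤ) (i : ZMod r) : ℤ :=
  ((p : ℤ) - 2 - dlt J i * b i) * ((p : ℤ) ^ r - 1) +
    (p : ℤ) * dlt J i * bet p r J b i -
      dlt J (i + 1) * bet p r J b (i + 1)

lemma dlt_eq_zero_or_one {r : ℕ} (J : Finset (ZMod r)) (i : ZMod r) :
    dlt J i = 0 ∨ dlt J i = 1 := by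
  unfold dlt
  split_ifs <;> simp

lemma sum_pow_reflect_mul_sub_one (x : ℤ) (r : ℕ) :
    ∑ j ∈ Finset.range r, x ^ (r - 1 - j) * (x - 1) = x ^ r - 1 := by
  rw [← Finset.sum_mul, Finset.sum_range_reflect (fun j => x ^ j) r, geom_sum_mul]

lemma neg_le_alph (p r : ℕ) (hp : 2 ≤ p) (J : Finset (ZMod r)) (b : ZMod r → ℤ)
    (hb : ∀ i, 0 ≤ b i) (i : ZMod r) : -((p : ℤ) ^ r - 1) ≤ alph p r J b i := by
  rw [← sum_pow_reflect_mul_sub_one, ← Finset.sum_neg_distrib, alph]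
  refine Finset.sum_le_sum fun j _ => ?_
  rw [← mul_neg]
  refine mul_le_mul_of_nonneg_left ?_ (by positivity)
  have h := hb (i + j)
  rcases dlt_eq_zero_or_one J (i + j) with h1 | h1 <;>
    rcases dlt_eq_zero_or_one J (i + j + 1) with h2 | h2 <;>
    rw [h1, h2] <;> omega

lemma bet_le (p r : ℕ) (hp : 1 ≤ p) (J : Finset (ZMod r)) (b : ZMod r → ℤ)
    (hb : ∀ i, b i ≤ (p : ℤ) - 1) (i : ZMod r) : bet p r J b i ≤ (p : ℤ) ^ r - 1 := by
  rw [← sum_pow_reflect_mul_sub_one, bet]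
  refine Finset.sum_le_sum fun j _ => ?_
  refine mul_le_mul_of_nonneg_left ?_ (by positivity)
  have h := hb (i + j)
  rcases dlt_eq_zero_or_one J (i + j) with h1 | h1 <;>
    rcases dlt_eq_zero_or_one J (i + j + 1) with h2 | h2 <;>
    rw [h1, h2] <;> omega

/-- For every i ∈ J, n'_i + p*ι_(i-1) - p*α_i ≥ n_i, where ι_(i-1) = α_i - β_i + e*δ_J(i). -/
theorem stmt12 (p r : ℕ) (hp : p.Prime) (hp5 : 5 ≤ p) (hr : 1 ≤ r)
    (J : Finset (ZMod r)) (b : ZMod r → ℤ)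
    (hb : ∀ i : ZMod r, 2 ≤ b i ∧ b i ≤ (p : ℤ) - 2) :
    ∀ i : ZMod r, i ∈ J →
      nn p r J b i ≤
        nn' p r J b i +
          (p : ℤ) * (alph p r J b i - bet p r J b i + ((p : ℤ) ^ r - 1) * dlt J i) -
            (p : ℤ) * alph p r J b i := by
  intro i hi
  have hα := neg_le_alph p r (by omega) J b (fun j => by linarith [(hb j).1]) (i + 1)
  have hβ := bet_le p r (by omega) J b (fun j => by linarith [(hb j).2]) (i + 1)
  have he : (0 : ℤ) ≤ (p : ℤ) ^ r - 1 :=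
    sub_nonneg.2 (one_le_pow₀ (by exact_mod_cast hp.one_le))
  have hbe := mul_nonneg (sub_nonneg.2 (hb i).2) he
  have hd : dlt J i = 1 := if_pos hi
  unfold nn nn'
  rw [hd]
  rcases dlt_eq_zero_or_one J (i + 1) with h | h <;> rw [h] <;> nlinarith
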